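/- Let Φ : Δ_ℚ → ℝ be a monotone additive statistic on Δ_ℚ. Then there exists a Borel probability measure μ on the extended real line ℝ̄ = ℝ∪{−∞,+∞} such that Φ[X] = ∫_{ℝ̄} K_a[X] dμ(a) for every X ∈ Δ_ℚ. -/

import Mathlib

open Filter Topology MeasureTheory

noncomputable section

namespace Paper

/-! ## Lotteries as finitely supported probability mass functions on ℝ -/

open Classical in
/-- The point mass at `a`. -/
def delta {α : Type*} (a : α) : α → ℝ := fun b => if b = a then 1 else 0

/-- `f` is (the p.m.f. of) a finitely supported lottery. -/
def IsFinLottery (f : ℝ → ℝ) : Prop :=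
  (∀ x, 0 ≤ f x) ∧ (Function.support f).Finite ∧ ∑ᶠ x, f x = 1

/-- The CDF of a mass function. -/
def cdfOf (f : ℝ → ℝ) (t : ℝ) : ℝ := ∑ᶠ x, if x ≤ t then f x else 0

/-- Convolution: the distribution of the sum of independent draws. -/
def conv (f g : ℝ → ℝ) : ℝ → ℝ := fun z => ∑ᶠ x, f x * g (z - x)

/-- Expectation of a finitely supported lottery. -/
def expOf (f : ℝ → ℝ) : ℝ := ∑ᶠ x, x * f x

/-- Weak first-order stochastic dominance of `f` over `g`. -/
def FOSDgeF (f g : ℝ → ℝ) : Prop := ∀ t, cdfOf f t ≤ cdfOf g t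

/-- Strict first-order stochastic dominance of `f` over `g`. -/
def FOSDgtF (f g : ℝ → ℝ) : Prop := FOSDgeF f g ∧ f ≠ g

/-- Finitely supported lotteries with rational-valued CDF (`Δ_ℚ`). -/
def IsDeltaQ (f : ℝ → ℝ) : Prop := IsFinLottery f ∧ ∀ t, ∃ q : ℚ, cdfOf f t = (q : ℝ)

/-- Monotone additive statistic on all finitely supported lotteries. -/
def MAS (Φ : (ℝ → ℝ) → ℝ) : Prop :=
  (∀ c : ℝ, Φ (delta c) = c) ∧
  (∀ f g, IsFinLottery f → IsFinLottery g → Φ (conv f g) = Φ f + Φ g) ∧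
  (∀ f g, IsFinLottery f → IsFinLottery g → FOSDgeF f g → Φ g ≤ Φ f)

/-- Monotone additive statistic on `Δ_ℚ`. -/
def MASQ (Φ : (ℝ → ℝ) → ℝ) : Prop :=
  (∀ c : ℝ, Φ (delta c) = c) ∧
  (∀ f g, IsDeltaQ f → IsDeltaQ g → Φ (conv f g) = Φ f + Φ g) ∧
  (∀ f g, IsDeltaQ f → IsDeltaQ g → FOSDgeF f g → Φ g ≤ Φ f)

/-- The statistic `K_a` for `a` in the extended real line. -/
def Kstat (a : EReal) (f : ℝ → ℝ) : ℝ :=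
  if a = ⊤ then sSup (Function.support f)
  else if a = ⊥ then sInf (Function.support f)
  else if a = 0 then expOf f
  else (a.toReal)⁻¹ * Real.log (∑ᶠ x, Real.exp (a.toReal * x) * f x)

/-- `K_a` for real `a`. -/
def Kreal (a : ℝ) : (ℝ → ℝ) → ℝ := Kstat (a : EReal)

/-- The statistic `Φ[X] = ∫ K_a[X] dμ(a)`. -/
def PhiInt (μ : Measure EReal) (f : ℝ → ℝ) : ℝ := ∫ a, Kstat a f ∂μ

/-! ## Finite normal-form games -/

structure Game (N : ℕ) where
  A : Fin N → Type
  fintypeA : ∀ i, Fintype (A i)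
  nonemptyA : ∀ i, Nonempty (A i)
  u : ((i : Fin N) → A i) → Fin N → ℝ

instance {N : ℕ} (G : Game N) (i : Fin N) : Fintype (G.A i) := G.fintypeA i
instance {N : ℕ} (G : Game N) (i : Fin N) : Nonempty (G.A i) := G.nonemptyA i

/-- A (mixed strategy) profile: a real-valued function on each action set. -/
abbrev Profile {N : ℕ} (G : Game N) := (i : Fin N) → G.A i → ℝ

/-- `p` is a mixed strategy profile. -/
def IsMixed {N : ℕ} (G : Game N) (p : Profile G) : Prop :=
  ∀ i, (∀ ai, 0 ≤ p i ai) ∧ ∑ ai, p i ai = 1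

/-- Probability of the full action profile `a` under independent mixing `p`. -/
def weight {N : ℕ} (G : Game N) (p : Profile G) (a : (i : Fin N) → G.A i) : ℝ :=
  ∏ j, p j (a j)

/-- The p.m.f. of player `i`'s payoff lottery `u_i(a_i, p_{-i})`. -/
def payMass {N : ℕ} (G : Game N) (p : Profile G) (i : Fin N) (ai : G.A i) : ℝ → ℝ :=
  fun t => ∑ a : (j : Fin N) → G.A j,
    if G.u a i = t then weight G (Function.update p i (delta ai)) a else 0

/-- Expected payoff `E[u_i(a_i, p_{-i})]`. -/
def expPay {N : ℕ} (G : Game N) (p : Profile G) (i : Fin N) (ai : G.A i) : ℝ :=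
  ∑ a : (j : Fin N) → G.A j, weight G (Function.update p i (delta ai)) a * G.u a i

/-- Expected value of `f` applied to player `i`'s payoff lottery. -/
def expPayOf {N : ℕ} (G : Game N) (p : Profile G) (i : Fin N) (ai : G.A i) (f : ℝ → ℝ) : ℝ :=
  ∑ a : (j : Fin N) → G.A j, weight G (Function.update p i (delta ai)) a * f (G.u a i)

/-- Minimum over `a_{-i}` of `u_i(a_i, a_{-i})`. -/
def minPay {N : ℕ} (G : Game N) (i : Fin N) (ai : G.A i) : ℝ :=
  ⨅ a : (j : Fin N) → G.A j, G.u (Function.update a i ai) i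

/-- Maximum over `a_{-i}` of `u_i(a_i, a_{-i})`. -/
def maxPay {N : ℕ} (G : Game N) (i : Fin N) (ai : G.A i) : ℝ :=
  ⨆ a : (j : Fin N) → G.A j, G.u (Function.update a i ai) i

/-- `a_i` is strictly dominated (by some `b_i`). -/
def StrictlyDominated {N : ℕ} (G : Game N) (i : Fin N) (ai : G.A i) : Prop :=
  ∃ bi : G.A i, ∀ a : (j : Fin N) → G.A j,
    G.u (Function.update a i ai) i < G.u (Function.update a i bi) i

/-! ## Solution concepts and axioms -/

abbrev SolCon (N : ℕ) := (G : Game N) → Set (Profile G)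

/-- A solution concept assigns to each game a nonempty set of mixed strategy profiles. -/
def IsSolutionConcept {N : ℕ} (S : SolCon N) : Prop :=
  ∀ G, (S G).Nonempty ∧ ∀ p ∈ S G, IsMixed G p

/-- The composite game `G ⊗ H`. -/
def Game.comp {N : ℕ} (G H : Game N) : Game N where
  A := fun i => G.A i × H.A i
  fintypeA := fun i => inferInstance
  nonemptyA := fun i => inferInstance
  u := fun c i => G.u (fun j => (c j).1) i + H.u (fun j => (c j).2) i

/-- The product profile `p × q`. -/
def prodProfile {N : ℕ} {G H : Game N} (p : Profile G) (q : Profile H) :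
    Profile (G.comp H) := fun i ab => p i ab.1 * q i ab.2

def Bracketing {N : ℕ} (S : SolCon N) : Prop :=
  ∀ (G H : Game N) (p : Profile G) (q : Profile H),
    p ∈ S G → q ∈ S H → prodProfile p q ∈ S (G.comp H)

/-- The permuted game `G_π`. -/
def Game.permute {N : ℕ} (G : Game N) (π : Equiv.Perm (Fin N)) : Game N where
  A := fun i => G.A (π i)
  fintypeA := fun i => G.fintypeA (π i)
  nonemptyA := fun i => G.nonemptyA (π i)
  u := fun b i =>
    G.u (fun j => cast (congrArg G.A (π.apply_symm_apply j)) (b (π.symm j))) (π i)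

def Anonymity {N : ℕ} (S : SolCon N) : Prop :=
  ∀ (π : Equiv.Perm (Fin N)) (G : Game N) (p : Profile G),
    p ∈ S G → (fun i => p (π i)) ∈ S (G.permute π)

def ExpectationMonotone {N : ℕ} (S : SolCon N) : Prop :=
  ∀ G, ∀ p ∈ S G, ∀ i, ∀ ai bi : G.A i,
    expPay G p i bi < expPay G p i ai → p i bi ≤ p i ai

def ExpectationNeutral {N : ℕ} (S : SolCon N) : Prop :=
  ∀ G, ∀ p ∈ S G, ∀ i, ∀ ai bi : G.A i,
    expPay G p i ai = expPay G p i bi → p i ai = p i bi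

def DistributionMonotone {N : ℕ} (S : SolCon N) : Prop :=
  ∀ G, ∀ p ∈ S G, ∀ i, ∀ ai bi : G.A i,
    FOSDgtF (payMass G p i ai) (payMass G p i bi) → p i bi ≤ p i ai

def Interiority {N : ℕ} (S : SolCon N) : Prop :=
  ∀ G, ∀ p ∈ S G, ∀ i, ∀ ai : G.A i, 0 < p i ai

/-- The game with payoffs rescaled by `α`. -/
def Game.scale {N : ℕ} (G : Game N) (α : ℝ) : Game N :=
  { G with u := fun a i => α * G.u a i }

def ScaleInvariant {N : ℕ} (S : SolCon N) : Prop :=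
  ∀ G : Game N, ∀ p ∈ S G,
    (∀ i, ∀ ai : G.A i, p i ai = ((Fintype.card (G.A i) : ℝ))⁻¹) →
    ∀ α ∈ Set.Ioo (0 : ℝ) 1, p ∈ S (G.scale α)

def StratInvariant {N : ℕ} (S : SolCon N) : Prop :=
  ∀ (G : Game N) (u' : ((i : Fin N) → G.A i) → Fin N → ℝ),
    (∀ i, ∃ w : ((j : Fin N) → G.A j) → ℝ,
      (∀ a, ∀ bi : G.A i, w (Function.update a i bi) = w a) ∧
      (∀ a, u' a i = G.u a i + w a)) →
    S G = S { G with u := u' }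

/-! ## Equilibrium notions -/

def IsNash {N : ℕ} (G : Game N) (p : Profile G) : Prop :=
  ∀ i, ∀ ai : G.A i, 0 < p i ai → ∀ bi : G.A i, expPay G p i bi ≤ expPay G p i ai

def IsLQRE {N : ℕ} (lam : ℝ) (G : Game N) (p : Profile G) : Prop :=
  ∀ i, ∀ ai : G.A i,
    p i ai = Real.exp (lam * expPay G p i ai) / ∑ bi, Real.exp (lam * expPay G p i bi)

def IsNashPhi {N : ℕ} (Φ : (ℝ → ℝ) → ℝ) (G : Game N) (p : Profile G) : Prop :=
  ∀ i, ∀ ai : G.A i, 0 < p i ai → ∀ bi : G.A i,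
    Φ (payMass G p i bi) ≤ Φ (payMass G p i ai)

def IsLQREPhi {N : ℕ} (Φ : (ℝ → ℝ) → ℝ) (lam : ℝ) (G : Game N) (p : Profile G) : Prop :=
  ∀ i, ∀ ai : G.A i,
    p i ai = Real.exp (lam * Φ (payMass G p i ai)) /
      ∑ bi, Real.exp (lam * Φ (payMass G p i bi))

def IsFOSDNash {N : ℕ} (G : Game N) (p : Profile G) : Prop :=
  ∀ i, ∀ ai : G.A i,
    (∃ bi : G.A i, FOSDgtF (payMass G p i bi) (payMass G p i ai)) → p i ai = 0

def IsFOSDQRE {N : ℕ} (G : Game N) (p : Profile G) : Prop :=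
  (∀ i, ∀ ai : G.A i, 0 < p i ai) ∧
  ∀ i, ∀ ai bi : G.A i,
    FOSDgeF (payMass G p i ai) (payMass G p i bi) → p i bi ≤ p i ai

def IsMinMaxMean {N : ℕ} (l1 l2 l3 : ℝ) (G : Game N) (p : Profile G) : Prop :=
  ∀ i, ∀ ai : G.A i,
    p i ai = Real.exp (l1 * minPay G i ai + l2 * expPay G p i ai + l3 * maxPay G i ai) /
      ∑ bi, Real.exp (l1 * minPay G i bi + l2 * expPay G p i bi + l3 * maxPay G i bi)

def CompatibleEU {N : ℕ} (S : SolCon N) : Prop :=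
  ∃ f : ℝ → ℝ, StrictMono f ∧ Continuous f ∧
    ∀ G, ∀ p ∈ S G, ∀ i, ∀ ai bi : G.A i,
      expPayOf G p i bi f < expPayOf G p i ai f → p i bi ≤ p i ai

/-! ## Lotteries as compactly supported probability measures on ℝ -/

/-- Convolution of measures: distribution of the sum of independent draws. -/
def mconv (μ ν : Measure ℝ) : Measure ℝ := (μ.prod ν).map (fun z : ℝ × ℝ => z.1 + z.2)

/-- `npow μ m` is the `m`-fold convolution `μ^m`. -/
def npow (μ : Measure ℝ) : ℕ → Measure ℝ
  | 0 => Measure.dirac 0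
  | n + 1 => mconv (npow μ n) μ

/-- The distribution of `β` times a draw from `μ`. -/
def mscale (β : ℝ) (μ : Measure ℝ) : Measure ℝ := μ.map (fun x => β * x)

/-- `μ` is compactly supported. -/
def CompSupp (μ : Measure ℝ) : Prop := ∃ a b : ℝ, μ (Set.Icc a b)ᶜ = 0

/-- The minimum of the support of `μ`. -/
def minSupp (μ : Measure ℝ) : ℝ := sSup {x : ℝ | μ (Set.Iio x) = 0}

/-- The maximum of the support of `μ`. -/
def maxSupp (μ : Measure ℝ) : ℝ := sInf {x : ℝ | μ (Set.Ioi x) = 0}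

/-- Weak first-order stochastic dominance of `μ` over `ν`. -/
def FOSDgeM (μ ν : Measure ℝ) : Prop := ∀ t, μ (Set.Iic t) ≤ ν (Set.Iic t)

/-- Strict first-order stochastic dominance of `μ` over `ν`. -/
def FOSDgtM (μ ν : Measure ℝ) : Prop := FOSDgeM μ ν ∧ μ ≠ ν

/-- Monotone additive statistic on compactly supported lotteries (as measures). -/
def MASm (Φ : Measure ℝ → ℝ) : Prop :=
  (∀ c : ℝ, Φ (Measure.dirac c) = c) ∧
  (∀ μ ν : Measure ℝ, IsProbabilityMeasure μ → IsProbabilityMeasure ν →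
    CompSupp μ → CompSupp ν → Φ (mconv μ ν) = Φ μ + Φ ν) ∧
  (∀ μ ν : Measure ℝ, IsProbabilityMeasure μ → IsProbabilityMeasure ν →
    CompSupp μ → CompSupp ν → FOSDgeM μ ν → Φ ν ≤ Φ μ)

/-! ## Two-player games, unbundled -/

/-- `p` is a probability distribution on the finite type `α`. -/
def IsDist {α : Type*} [Fintype α] (p : α → ℝ) : Prop :=
  (∀ a, 0 ≤ p a) ∧ ∑ a, p a = 1

/-- Payoff lottery of player 1 playing `a` against the mixed strategy `q`. -/
def mass1 {α β : Type*} [Fintype β] (u : α → β → ℝ) (q : β → ℝ) (a : α) : ℝ → ℝ :=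
  fun t => ∑ b, if u a b = t then q b else 0

/-- Payoff lottery of player 2 playing `b` against the mixed strategy `p`. -/
def mass2 {α β : Type*} [Fintype α] (u : α → β → ℝ) (p : α → ℝ) (b : β) : ℝ → ℝ :=
  fun t => ∑ a, if u a b = t then p a else 0

/-- The distribution of a random variable on the uniform space `{1,…,m}`. -/
def distOf {m : ℕ} (X : Fin m → ℝ) : ℝ → ℝ :=
  fun t => (∑ ω : Fin m, if X ω = t then (1 : ℝ) else 0) / m


/-! ## Lotteries given by finite weighted families -/

section Law

variable {ι κ : Type} [Fintype ι] [Fintype κ]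

open Classical in
/-- The lottery that takes the value `x i` with weight `w i`. -/
def law (w x : ι → ℝ) : ℝ → ℝ := fun t => ∑ i, if x i = t then w i else 0

/-- Positive rational weights summing to one. -/
structure RatWeights (w : ι → ℝ) : Prop where
  pos : ∀ i, 0 < w i
  sum_eq_one : ∑ i, w i = 1
  rat : ∀ i, ∃ q : ℚ, w i = (q : ℝ)

theorem RatWeights.nonempty {w : ι → ℝ} (hw : RatWeights w) : Nonempty ι := by
  by_contra h
  rw [not_nonempty_iff] at h
  simpa using hw.sum_eq_one

theorem RatWeights.mul {w : ι → ℝ} {v : κ → ℝ} (hw : RatWeights w) (hv : RatWeights v) :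
    RatWeights (fun p : ι × κ => w p.1 * v p.2) where
  pos p := mul_pos (hw.pos _) (hv.pos _)
  sum_eq_one := by
    rw [Fintype.sum_prod_type, ← Finset.sum_mul_sum, hw.sum_eq_one, hv.sum_eq_one, one_mul]
  rat p := by
    obtain ⟨q, hq⟩ := hw.rat p.1
    obtain ⟨r, hr⟩ := hv.rat p.2
    exact ⟨q * r, by push_cast; rw [hq, hr]⟩

theorem support_law_subset (w x : ι → ℝ) : Function.support (law w x) ⊆ Set.range x := by
  intro t ht
  obtain ⟨i, -, hi⟩ := Finset.exists_ne_zero_of_sum_ne_zero (Function.mem_support.1 ht)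
  exact ⟨i, by by_contra h; simp [h] at hi⟩

theorem support_law {w : ι → ℝ} (hw : ∀ i, 0 < w i) (x : ι → ℝ) :
    Function.support (law w x) = Set.range x := by
  refine (support_law_subset w x).antisymm ?_
  rintro _ ⟨i, rfl⟩
  refine (lt_of_lt_of_le (hw i) ?_).ne'
  calc w i = if x i = x i then w i else 0 := by simp
    _ ≤ law w x (x i) := Finset.single_le_sum (f := fun j => if x j = x i then w j else 0)
        (fun j _ => by split_ifs <;> simp [(hw j).le]) (Finset.mem_univ i)

theorem finsum_mul_law (g : ℝ → ℝ) (w x : ι → ℝ) :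
    ∑ᶠ t, g t * law w x t = ∑ i, g (x i) * w i := by
  classical
  rw [finsum_eq_sum_of_support_subset (s := Finset.univ.image x)]
  · simp only [law, Finset.mul_sum]
    rw [Finset.sum_comm]
    refine Finset.sum_congr rfl fun i _ => ?_
    simp [mul_ite]
  · refine (Function.support_mul_subset_right _ _).trans ((support_law_subset w x).trans ?_)
    simp

theorem cdfOf_law (w x : ι → ℝ) (t : ℝ) :
    cdfOf (law w x) t = ∑ i, if x i ≤ t then w i else 0 := by
  have := finsum_mul_law (fun s => if s ≤ t then 1 else 0) w x
  simpa [cdfOf, ite_mul] using this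

theorem RatWeights.isDeltaQ {w : ι → ℝ} (hw : RatWeights w) (x : ι → ℝ) :
    IsDeltaQ (law w x) := by
  refine ⟨⟨fun t => ?_, (Set.finite_range x).subset (support_law_subset w x), ?_⟩, fun t => ?_⟩
  · exact Finset.sum_nonneg fun i _ => by split_ifs <;> simp [(hw.pos i).le]
  · simpa [hw.sum_eq_one] using finsum_mul_law (fun _ => 1) w x
  · choose q hq using hw.rat
    refine ⟨∑ i, if x i ≤ t then q i else 0, ?_⟩
    simp [cdfOf_law, hq, apply_ite (Rat.cast : ℚ → ℝ)]

theorem conv_law (w x : ι → ℝ) (v y : κ → ℝ) :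
    conv (law w x) (law v y) =
      law (fun p : ι × κ => w p.1 * v p.2) (fun p => x p.1 + y p.2) := by
  classical
  funext z
  have h := finsum_mul_law (fun t => law v y (z - t)) w x
  simp only [conv, mul_comm (law w x _)]
  rw [h]
  simp only [law, Fintype.sum_prod_type, Finset.sum_mul]
  refine Finset.sum_congr rfl fun i _ => Finset.sum_congr rfl fun j _ => ?_
  have : y j = z - x i ↔ x i + y j = z := by constructor <;> intro h <;> linarith
  simp [this, mul_comm]

theorem law_const {w : ι → ℝ} (hw : ∑ i, w i = 1) (c : ℝ) : law w (fun _ => c) = delta c := by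
  classical
  funext t
  by_cases h : t = c
  · simp [law, delta, h, hw]
  · simp [law, delta, h, Ne.symm h]

theorem ratWeights_one : RatWeights (fun _ : Unit => (1 : ℝ)) :=
  ⟨fun _ => one_pos, by simp, fun _ => ⟨1, by simp⟩⟩

theorem cdfOf_eq_sum {f : ℝ → ℝ} (hf : (Function.support f).Finite) (t : ℝ) :
    cdfOf f t = ∑ x ∈ hf.toFinset, if x ≤ t then f x else 0 :=
  finsum_eq_sum_of_support_subset _ fun x hx => by
    rw [Function.mem_support] at hx
    simp only [Set.Finite.coe_toFinset, Function.mem_support]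
    rintro h
    simp [h] at hx

theorem IsDeltaQ.rat_apply {f : ℝ → ℝ} (hf : IsDeltaQ f) (t : ℝ) : ∃ q : ℚ, f t = (q : ℝ) := by
  have hfin := hf.1.2.1
  have hmem : (Function.support f \ {t})ᶜ ∈ 𝓝 t :=
    ((hfin.subset Set.sdiff_subset).isClosed.isOpen_compl).mem_nhds (by simp)
  obtain ⟨ε, hε, hball⟩ := Metric.mem_nhds_iff.1 hmem
  obtain ⟨q, hq⟩ := hf.2 t
  obtain ⟨r, hr⟩ := hf.2 (t - ε / 2)
  refine ⟨q - r, ?_⟩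
  push_cast
  rw [← hq, ← hr, cdfOf_eq_sum hfin, cdfOf_eq_sum hfin, ← Finset.sum_sub_distrib]
  have key : ∀ s ∈ hfin.toFinset, s ≠ t →
      ((if s ≤ t then f s else 0) - if s ≤ t - ε / 2 then f s else 0) = 0 := by
    intro s hs hst
    have hs' : s ∉ Metric.ball t ε := fun h => hball h ⟨by simpa using hs, hst⟩
    rw [Real.ball_eq_Ioo, Set.mem_Ioo, not_and_or, not_lt, not_lt] at hs'
    rcases hs' with h | h
    · rw [if_pos (by linarith), if_pos (by linarith), sub_self]
    · rw [if_neg (by linarith), if_neg (by linarith), sub_self]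
  by_cases ht : t ∈ hfin.toFinset
  · rw [Finset.sum_eq_single_of_mem t ht key, if_pos le_rfl, if_neg (by linarith), sub_zero]
  · rw [Finset.sum_eq_zero fun s hs => key s hs (by rintro rfl; exact ht hs)]
    simpa using ht

theorem IsDeltaQ.exists_law {f : ℝ → ℝ} (hf : IsDeltaQ f) :
    ∃ (ι : Type) (_ : Fintype ι) (w x : ι → ℝ), RatWeights w ∧ f = law w x := by
  classical
  have hfin := hf.1.2.1
  refine ⟨hfin.toFinset, inferInstance, fun i => f i, fun i => i, ⟨fun i => ?_, ?_, fun i => ?_⟩, ?_⟩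
  · exact lt_of_le_of_ne (hf.1.1 i) (Ne.symm (hfin.mem_toFinset.1 i.2))
  · rw [Finset.sum_coe_sort hfin.toFinset f, ← hf.1.2.2]
    exact (finsum_eq_sum_of_support_subset _ (by simp)).symm
  · exact hf.rat_apply i
  · funext t
    rw [law, Finset.sum_coe_sort hfin.toFinset (fun s => if s = t then f s else 0)]
    rw [Finset.sum_ite_eq']
    split_ifs with h
    · rfl
    · simpa using h

end Law

/-! ## The statistics `K_a` on weighted families -/

section Kstat

variable {ι κ : Type} [Fintype ι] [Fintype κ]

/-- The moment generating function of a weighted family. -/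
def mgfOf (w x : ι → ℝ) (a : ℝ) : ℝ := ∑ i, Real.exp (a * x i) * w i

theorem mgfOf_pos [Nonempty ι] {w : ι → ℝ} (hw : ∀ i, 0 < w i) (x : ι → ℝ) (a : ℝ) :
    0 < mgfOf w x a :=
  Finset.sum_pos (fun i _ => mul_pos (Real.exp_pos _) (hw i)) Finset.univ_nonempty

theorem mgfOf_add (w x : ι → ℝ) (v y : κ → ℝ) (a : ℝ) :
    mgfOf (fun p : ι × κ => w p.1 * v p.2) (fun p => x p.1 + y p.2) a =
      mgfOf w x a * mgfOf v y a := by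
  simp only [mgfOf, Fintype.sum_prod_type, Finset.sum_mul_sum, mul_add, Real.exp_add]
  exact Finset.sum_congr rfl fun i _ => Finset.sum_congr rfl fun j _ => by ring

theorem hasDerivAt_mgfOf (w x : ι → ℝ) (a : ℝ) :
    HasDerivAt (mgfOf w x) (∑ i, Real.exp (a * x i) * x i * w i) a := by
  unfold mgfOf
  refine HasDerivAt.fun_sum fun i _ => HasDerivAt.mul_const ?_ _
  simpa using ((hasDerivAt_id a).mul_const (x i)).exp

theorem expOf_law (w x : ι → ℝ) : expOf (law w x) = ∑ i, x i * w i :=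
  finsum_mul_law (fun t => t) w x

theorem Kstat_top (f : ℝ → ℝ) : Kstat ⊤ f = sSup (Function.support f) := by simp [Kstat]

theorem Kstat_bot (f : ℝ → ℝ) : Kstat ⊥ f = sInf (Function.support f) := by simp [Kstat]

theorem Kstat_zero (f : ℝ → ℝ) : Kstat 0 f = expOf f := by simp [Kstat]

theorem Kstat_coe_law {a : ℝ} (ha : a ≠ 0) (w x : ι → ℝ) :
    Kstat a (law w x) = a⁻¹ * Real.log (mgfOf w x a) := by
  simp only [Kstat, EReal.coe_ne_top, EReal.coe_ne_bot, if_false, EReal.coe_eq_zero, ha,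
    EReal.toReal_coe]
  rw [finsum_mul_law (fun t => Real.exp (a * t)), mgfOf]

open scoped Pointwise in
theorem Kstat_law_add {w : ι → ℝ} {v : κ → ℝ} (hw : RatWeights w) (hv : RatWeights v)
    (x : ι → ℝ) (y : κ → ℝ) (a : EReal) :
    Kstat a (law (fun p : ι × κ => w p.1 * v p.2) (fun p => x p.1 + y p.2)) =
      Kstat a (law w x) + Kstat a (law v y) := by
  have := hw.nonempty
  have := hv.nonempty
  have hrange : Set.range (fun p : ι × κ => x p.1 + y p.2) = Set.range x + Set.range y := by
    ext t
    simp [Set.mem_add]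
  induction a with
  | bot =>
    rw [Kstat_bot, Kstat_bot, Kstat_bot, support_law (hw.mul hv).pos, support_law hw.pos,
      support_law hv.pos, hrange]
    exact csInf_add (Set.range_nonempty x) (Set.finite_range x).bddBelow
      (Set.range_nonempty y) (Set.finite_range y).bddBelow
  | top =>
    rw [Kstat_top, Kstat_top, Kstat_top, support_law (hw.mul hv).pos, support_law hw.pos,
      support_law hv.pos, hrange]
    exact csSup_add (Set.range_nonempty x) (Set.finite_range x).bddAbove
      (Set.range_nonempty y) (Set.finite_range y).bddAbove
  | coe a =>
    by_cases ha : a = 0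
    · subst ha
      rw [EReal.coe_zero, Kstat_zero, Kstat_zero, Kstat_zero, expOf_law, expOf_law, expOf_law]
      have h1 : ∑ i, x i * w i = ∑ p : ι × κ, x p.1 * w p.1 * v p.2 := by
        simp only [Fintype.sum_prod_type]
        rw [← Finset.sum_mul_sum, hv.sum_eq_one, mul_one]
      have h2 : ∑ j, y j * v j = ∑ p : ι × κ, w p.1 * (y p.2 * v p.2) := by
        simp only [Fintype.sum_prod_type]
        rw [← Finset.sum_mul_sum, hw.sum_eq_one, one_mul]
      rw [h1, h2, ← Finset.sum_add_distrib]
      exact Finset.sum_congr rfl fun p _ => by ring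
    · rw [Kstat_coe_law ha, Kstat_coe_law ha, Kstat_coe_law ha, mgfOf_add,
        Real.log_mul (mgfOf_pos hw.pos x a).ne' (mgfOf_pos hv.pos y a).ne', mul_add]

theorem Kstat_delta (a : EReal) (c : ℝ) : Kstat a (delta c) = c := by
  have hd := law_const ratWeights_one.sum_eq_one c
  rw [← hd]
  induction a with
  | bot => rw [Kstat_bot, support_law ratWeights_one.pos]; simp
  | top => rw [Kstat_top, support_law ratWeights_one.pos]; simp
  | coe a =>
    by_cases ha : a = 0
    · subst ha
      rw [EReal.coe_zero, Kstat_zero, expOf_law]; simp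
    · rw [Kstat_coe_law ha]
      simp [mgfOf, ha]

theorem tendsto_Kstat_atTop {w : ι → ℝ} (hw : RatWeights w) (x : ι → ℝ) :
    Tendsto (fun a : ℝ => Kstat a (law w x)) atTop (𝓝 (sSup (Set.range x))) := by
  have := hw.nonempty
  obtain ⟨i, hi⟩ := Set.mem_range.1 ((Set.range_nonempty x).csSup_mem (Set.finite_range x))
  have hle : ∀ j, x j ≤ sSup (Set.range x) := fun j =>
    le_csSup (Set.finite_range x).bddAbove ⟨j, rfl⟩
  have hlow : Tendsto (fun a : ℝ => x i + a⁻¹ * Real.log (w i)) atTop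
      (𝓝 (sSup (Set.range x))) := by
    simpa [hi] using (tendsto_inv_atTop_zero.mul_const (Real.log (w i))).const_add (x i)
  refine tendsto_of_tendsto_of_tendsto_of_le_of_le' hlow tendsto_const_nhds ?_ ?_
  · filter_upwards [eventually_gt_atTop 0] with a ha
    rw [Kstat_coe_law ha.ne']
    have h1 : Real.exp (a * x i) * w i ≤ mgfOf w x a :=
      Finset.single_le_sum (f := fun j => Real.exp (a * x j) * w j)
        (fun j _ => (mul_pos (Real.exp_pos _) (hw.pos j)).le) (Finset.mem_univ i)
    have h2 := Real.log_le_log (mul_pos (Real.exp_pos _) (hw.pos i)) h1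
    rw [Real.log_mul (Real.exp_pos _).ne' (hw.pos i).ne', Real.log_exp] at h2
    calc x i + a⁻¹ * Real.log (w i) = a⁻¹ * (a * x i + Real.log (w i)) := by field_simp
      _ ≤ _ := by gcongr
  · filter_upwards [eventually_gt_atTop 0] with a ha
    rw [Kstat_coe_law ha.ne']
    have h1 : mgfOf w x a ≤ Real.exp (a * sSup (Set.range x)) := by
      calc mgfOf w x a ≤ ∑ j, Real.exp (a * sSup (Set.range x)) * w j :=
            Finset.sum_le_sum fun j _ => mul_le_mul_of_nonneg_right
              (Real.exp_le_exp.2 (mul_le_mul_of_nonneg_left (hle j) ha.le)) (hw.pos j).le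
        _ = _ := by rw [← Finset.mul_sum, hw.sum_eq_one, mul_one]
    have h2 := Real.log_le_log (mgfOf_pos hw.pos x a) h1
    rw [Real.log_exp] at h2
    calc a⁻¹ * Real.log (mgfOf w x a) ≤ a⁻¹ * (a * sSup (Set.range x)) := by gcongr
      _ = _ := by field_simp

theorem Kstat_neg_coe_law (w x : ι → ℝ) (a : ℝ) :
    Kstat ((-a : ℝ) : EReal) (law w x) = -Kstat a (law w (-x)) := by
  by_cases ha : a = 0
  · subst ha
    simp [-EReal.coe_neg, Kstat_zero, expOf_law]
  · rw [Kstat_coe_law ha, Kstat_coe_law (neg_ne_zero.2 ha)]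
    simp [mgfOf, inv_neg]

theorem tendsto_Kstat_atBot {w : ι → ℝ} (hw : RatWeights w) (x : ι → ℝ) :
    Tendsto (fun a : ℝ => Kstat a (law w x)) atBot (𝓝 (sInf (Set.range x))) := by
  have h := ((tendsto_Kstat_atTop hw (-x)).comp tendsto_neg_atBot_atTop).neg
  have hrange : Set.range (-x) = -Set.range x := by
    ext t
    simp [neg_eq_iff_eq_neg]
  rw [hrange, ← Real.sInf_def] at h
  refine h.congr fun a => ?_
  simp only [Function.comp_apply]
  rw [← Kstat_neg_coe_law, neg_neg]

theorem tendsto_Kstat_zero {w : ι → ℝ} (hw : RatWeights w) (x : ι → ℝ) :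
    Tendsto (fun a : ℝ => Kstat a (law w x)) (𝓝[≠] 0) (𝓝 (expOf (law w x))) := by
  have h0 : mgfOf w x 0 = 1 := by simp [mgfOf, hw.sum_eq_one]
  have h := (hasDerivAt_mgfOf w x 0).log (by simp [h0])
  rw [hasDerivAt_iff_tendsto_slope] at h
  simp only [zero_mul, Real.exp_zero, one_mul, h0, div_one] at h
  rw [expOf_law]
  refine h.congr' ?_
  filter_upwards [self_mem_nhdsWithin] with a ha
  rw [Kstat_coe_law ha, slope_def_field, h0, Real.log_one, sub_zero, sub_zero]
  ring

theorem continuous_Kstat {w : ι → ℝ} (hw : RatWeights w) (x : ι → ℝ) :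
    Continuous fun a => Kstat a (law w x) := by
  have := hw.nonempty
  refine continuous_iff_continuousAt.2 fun a => ?_
  induction a with
  | bot =>
    rw [continuousAt_iff_punctured_nhds, EReal.nhdsWithin_bot, tendsto_map'_iff, Kstat_bot,
      support_law hw.pos]
    exact tendsto_Kstat_atBot hw x
  | top =>
    rw [continuousAt_iff_punctured_nhds, EReal.nhdsWithin_top, tendsto_map'_iff, Kstat_top,
      support_law hw.pos]
    exact tendsto_Kstat_atTop hw x
  | coe a =>
    rw [← EReal.isOpenEmbedding_coe.continuousAt_iff]
    by_cases ha : a = 0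
    · subst ha
      rw [continuousAt_iff_punctured_nhds]
      simpa [Function.comp_def, Kstat_zero] using tendsto_Kstat_zero hw x
    · have hc : ContinuousAt (fun b : ℝ => b⁻¹ * Real.log (mgfOf w x b)) a :=
        (continuousAt_inv₀ ha).mul
          ((hasDerivAt_mgfOf w x a).continuousAt.log (mgfOf_pos hw.pos x a).ne')
      refine hc.congr ?_
      filter_upwards [isOpen_ne.mem_nhds ha] with b hb
      exact (Kstat_coe_law hb w x).symm

end Kstat

/-! ## Pólya's theorem in one variable -/

section Polya

open Polynomial

/-- The coefficients of `(1 + X) ^ N * r`, up to a multinomial factor, are values of this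
function at `h = 1 / (N + d)`; at `h = 0` it is the homogenisation of `r`. -/
def polyaForm (r : ℝ[X]) (p : ℝ × ℝ) : ℝ :=
  ∑ k ∈ Finset.range (r.natDegree + 1), r.coeff k *
    ((∏ l ∈ Finset.range k, (p.1 - l * p.2)) *
      ∏ l ∈ Finset.range (r.natDegree - k), (1 - p.1 - l * p.2))

theorem continuous_polyaForm (r : ℝ[X]) : Continuous (polyaForm r) := by
  unfold polyaForm
  fun_prop

theorem polyaForm_zero_pos {r : ℝ[X]} (hr : ∀ t, 0 < t → 0 < r.eval t) (h0 : 0 < r.coeff 0)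
    (hlead : 0 < r.leadingCoeff) {s : ℝ} (hs : s ∈ Set.Icc (0 : ℝ) 1) :
    0 < polyaForm r (s, 0) := by
  have hform : polyaForm r (s, 0) = ∑ k ∈ Finset.range (r.natDegree + 1), r.coeff k *
      (s ^ k * (1 - s) ^ (r.natDegree - k)) := by simp [polyaForm]
  rw [hform]
  rcases hs.1.eq_or_lt with rfl | hs0
  · rw [Finset.sum_eq_single_of_mem 0 (by simp)]
    · simpa using h0
    · intro k _ hk
      simp [hk]
  rcases hs.2.eq_or_lt with rfl | hs1
  · rw [Finset.sum_eq_single_of_mem r.natDegree (by simp)]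
    · simpa using hlead
    · intro k hk hkd
      have : r.natDegree - k ≠ 0 := by
        have := Finset.mem_range.1 hk
        omega
      simp [this]
  · have h1 : 0 < 1 - s := by linarith
    have : ∑ k ∈ Finset.range (r.natDegree + 1), r.coeff k *
        (s ^ k * (1 - s) ^ (r.natDegree - k)) = (1 - s) ^ r.natDegree * r.eval (s / (1 - s)) := by
      rw [eval_eq_sum_range, Finset.mul_sum]
      refine Finset.sum_congr rfl fun k hk => ?_
      have hk' : k ≤ r.natDegree := by
        have := Finset.mem_range.1 hk
        omega
      rw [← Nat.sub_add_cancel hk', Nat.add_sub_cancel, pow_add, div_pow]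
      field_simp
    rw [this]
    exact mul_pos (pow_pos h1 _) (hr _ (div_pos hs0 h1))

theorem prod_range_sub_eq_descFactorial (n k : ℕ) :
    ∏ l ∈ Finset.range k, ((n : ℝ) - l) = n.descFactorial k := by
  rw [← descPochhammer_eval_eq_prod_range, descPochhammer_eval_eq_descFactorial]

theorem choose_mul_factorials {N d i k : ℕ} (hk : k ≤ d) (hi : i ≤ N + d) :
    (if k ≤ i then N.choose (i - k) else 0) * (i.factorial * (N + d - i).factorial) =
      N.factorial * (i.descFactorial k * (N + d - i).descFactorial (d - k)) := by
  by_cases hki : k ≤ i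
  · rw [if_pos hki]
    by_cases h : d - k ≤ N + d - i
    · have h1 := Nat.factorial_mul_descFactorial hki
      have h2 := Nat.factorial_mul_descFactorial h
      have h3 := Nat.choose_mul_factorial_mul_factorial (show i - k ≤ N by omega)
      have h4 : N + d - i - (d - k) = N - (i - k) := by omega
      rw [h4] at h2
      rw [← h1, ← h2, ← h3]
      ring
    · rw [Nat.choose_eq_zero_of_lt (by omega), (Nat.descFactorial_eq_zero_iff_lt).2 (by omega :
        N + d - i < d - k)]
      simp
  · rw [if_neg hki, (Nat.descFactorial_eq_zero_iff_lt).2 (by omega : i < k)]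
    simp

theorem coeff_one_add_X_pow_mul (r : ℝ[X]) (N i : ℕ) :
    ((1 + X) ^ N * r).coeff i = ∑ k ∈ Finset.range (r.natDegree + 1),
      r.coeff k * ((if k ≤ i then N.choose (i - k) else 0 : ℕ) : ℝ) := by
  conv_lhs => rw [r.as_sum_range_C_mul_X_pow, Finset.mul_sum, finsetSum_coeff]
  refine Finset.sum_congr rfl fun k _ => ?_
  rw [mul_left_comm, coeff_C_mul, coeff_mul_X_pow']
  split_ifs <;> simp [coeff_one_add_X_pow]

theorem polyaForm_eq (r : ℝ[X]) {N i : ℕ} (hM : 0 < N + r.natDegree)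
    (hi : i ≤ N + r.natDegree) :
    ((1 + X) ^ N * r).coeff i * (i.factorial * (N + r.natDegree - i).factorial : ℕ) =
      N.factorial * ((N + r.natDegree : ℕ) : ℝ) ^ r.natDegree *
        polyaForm r ((i : ℝ) / (N + r.natDegree : ℕ), 1 / (N + r.natDegree : ℕ)) := by
  set d := r.natDegree with hd
  have hM' : ((N + d : ℕ) : ℝ) ≠ 0 := by exact_mod_cast hM.ne'
  rw [coeff_one_add_X_pow_mul, polyaForm, ← hd, Finset.sum_mul, Finset.mul_sum]
  refine Finset.sum_congr rfl fun k hk => ?_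
  have hk' : k ≤ d := by
    have := Finset.mem_range.1 hk
    omega
  have e1 : ∏ l ∈ Finset.range k, ((i : ℝ) / (N + d : ℕ) - l * (1 / (N + d : ℕ))) =
      i.descFactorial k / ((N + d : ℕ) : ℝ) ^ k := by
    rw [← prod_range_sub_eq_descFactorial, eq_div_iff (pow_ne_zero _ hM')]
    conv_lhs => enter [2, 2]; rw [← Finset.card_range k]
    rw [Finset.prod_mul_pow_card]
    exact Finset.prod_congr rfl fun l _ => by field_simp
  have e2 : ∏ l ∈ Finset.range (d - k), (1 - (i : ℝ) / (N + d : ℕ) - l * (1 / (N + d : ℕ))) =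
      (N + d - i).descFactorial (d - k) / ((N + d : ℕ) : ℝ) ^ (d - k) := by
    rw [← prod_range_sub_eq_descFactorial, eq_div_iff (pow_ne_zero _ hM')]
    conv_lhs => enter [2, 2]; rw [← Finset.card_range (d - k)]
    rw [Finset.prod_mul_pow_card]
    refine Finset.prod_congr rfl fun l _ => ?_
    rw [Nat.cast_sub hi]
    field_simp
  rw [e1, e2, mul_assoc, ← Nat.cast_mul, choose_mul_factorials hk' hi]
  have e3 : ((N + d : ℕ) : ℝ) ^ d = ((N + d : ℕ) : ℝ) ^ k * ((N + d : ℕ) : ℝ) ^ (d - k) := by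
    rw [← pow_add, Nat.add_sub_cancel' hk']
  rw [e3, Nat.cast_mul, Nat.cast_mul]
  field_simp

theorem exists_pow_mul_coeff_nonneg_of_coeff_zero_pos {r : ℝ[X]}
    (hr : ∀ t, 0 < t → 0 < r.eval t) (h0 : 0 < r.coeff 0) (hlead : 0 < r.leadingCoeff) :
    ∃ N : ℕ, ∀ i, 0 ≤ ((1 + X) ^ N * r).coeff i := by
  have hev : ∀ᶠ h in 𝓝 (0 : ℝ), ∀ s ∈ Set.Icc (0 : ℝ) 1, 0 < polyaForm r (s, h) := by
    refine isCompact_Icc.eventually_forall_of_forall_eventually fun s hs => ?_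
    have hcont : ContinuousAt (fun z : ℝ × ℝ => polyaForm r (z.2, z.1)) (0, s) :=
      ((continuous_polyaForm r).comp continuous_swap).continuousAt
    exact hcont.eventually (lt_mem_nhds (polyaForm_zero_pos hr h0 hlead hs))
  have hlim : Tendsto (fun N : ℕ => 1 / ((N + r.natDegree : ℕ) : ℝ)) atTop (𝓝 0) :=
    (tendsto_one_div_atTop_nhds_zero_nat (𝕜 := ℝ)).comp (tendsto_add_atTop_nat r.natDegree)
  obtain ⟨N, hN, hN0⟩ := ((hlim.eventually hev).and (eventually_gt_atTop 0)).exists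
  refine ⟨N, fun i => ?_⟩
  by_cases hi : i ≤ N + r.natDegree
  · have hM : (0 : ℝ) < (N + r.natDegree : ℕ) := by exact_mod_cast (by omega)
    have hpos : (0 : ℝ) < (i.factorial * (N + r.natDegree - i).factorial : ℕ) := by
      exact_mod_cast Nat.mul_pos i.factorial_pos (Nat.factorial_pos _)
    refine nonneg_of_mul_nonneg_left ?_ hpos
    rw [polyaForm_eq r (by omega) hi]
    refine mul_nonneg (by positivity) (hN _ ⟨by positivity, ?_⟩).le
    rw [div_le_one hM]
    exact_mod_cast hi
  · rw [coeff_eq_zero_of_natDegree_lt]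
    refine lt_of_le_of_lt (natDegree_mul_le.trans (add_le_add_left ?_ _)) (not_le.1 hi)
    refine natDegree_pow_le.trans ?_
    have : (1 + X : ℝ[X]).natDegree ≤ 1 := by compute_degree
    nlinarith

theorem leadingCoeff_pos_of_eval_pos {r : ℝ[X]} (hr : ∀ t, 0 < t → 0 < r.eval t) :
    0 < r.leadingCoeff := by
  by_contra hneg
  rw [not_lt] at hneg
  rcases lt_or_ge 0 r.degree with hdeg | hdeg
  · obtain ⟨t, ht, ht0⟩ := (((r.tendsto_atBot_of_leadingCoeff_nonpos hdeg hneg).eventually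
      (eventually_lt_atBot 0)).and (eventually_gt_atTop 0)).exists
    exact (hr t ht0).not_gt ht
  · rw [eq_C_of_degree_le_zero hdeg] at hr hneg
    simp only [eval_C, leadingCoeff_C] at hr hneg
    exact (hr 1 one_pos).not_ge hneg

/-- **Pólya's theorem** in one variable: a polynomial that is positive on the positive half-line
has nonnegative coefficients after multiplication with a power of `1 + X`. -/
theorem exists_pow_mul_coeff_nonneg {r : ℝ[X]} (hr : ∀ t, 0 < t → 0 < r.eval t) :
    ∃ N : ℕ, ∀ i, 0 ≤ ((1 + X) ^ N * r).coeff i := by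
  have hr0 : r ≠ 0 := by
    rintro rfl
    simpa using hr 1 one_pos
  obtain ⟨g, hg, hX⟩ := exists_eq_pow_rootMultiplicity_mul_and_not_dvd r hr0 0
  rw [C_0, sub_zero] at hg hX
  have hgpos : ∀ t, 0 < t → 0 < g.eval t := by
    intro t ht
    have h := hr t ht
    rw [hg, eval_mul, eval_pow, eval_X] at h
    exact pos_of_mul_pos_right h (by positivity)
  have hg0 : 0 < g.coeff 0 := by
    refine lt_of_le_of_ne ?_ fun h => hX (X_dvd_iff.2 h.symm)
    rw [coeff_zero_eq_eval_zero]
    refine ge_of_tendsto (x := 𝓝[>] 0) (g.continuous.tendsto 0 |>.mono_left nhdsWithin_le_nhds) ?_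
    filter_upwards [self_mem_nhdsWithin] with t ht using (hgpos t ht).le
  obtain ⟨N, hN⟩ := exists_pow_mul_coeff_nonneg_of_coeff_zero_pos hgpos hg0
    (leadingCoeff_pos_of_eval_pos hgpos)
  refine ⟨N, fun i => ?_⟩
  rw [hg, mul_left_comm, coeff_X_pow_mul']
  split_ifs
  · exact hN _
  · exact le_rfl

end Polya

/-! ## Comparison of lotteries on a lattice -/

section Lattice

open Polynomial

variable {ι κ : Type} [Fintype ι] [Fintype κ]

/-- The probability generating function of a weighted family of natural numbers. -/
def genPoly (w : ι → ℝ) (m : ι → ℕ) : ℝ[X] := ∑ i, monomial (m i) (w i)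

theorem genPoly_mul (w : ι → ℝ) (m : ι → ℕ) (v : κ → ℝ) (n : κ → ℕ) :
    genPoly w m * genPoly v n =
      genPoly (fun p : ι × κ => w p.1 * v p.2) (fun p => m p.1 + n p.2) := by
  simp only [genPoly, Fintype.sum_prod_type, Finset.sum_mul_sum, monomial_mul_monomial]

theorem eval_genPoly (w : ι → ℝ) (m : ι → ℕ) (t : ℝ) :
    (genPoly w m).eval t = ∑ i, w i * t ^ m i := by
  simp [genPoly, eval_finsetSum, eval_monomial]

theorem eval_one_derivative_genPoly (w : ι → ℝ) (m : ι → ℕ) :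
    (derivative (genPoly w m)).eval 1 = ∑ i, m i * w i := by
  simp [genPoly, eval_finsetSum, derivative_monomial, mul_comm]

theorem sum_coeff_genPoly (w : ι → ℝ) (m : ι → ℕ) (T : ℕ) :
    ∑ j ∈ Finset.range (T + 1), (genPoly w m).coeff j = ∑ i, if m i ≤ T then w i else 0 := by
  simp only [genPoly, finsetSum_coeff, coeff_monomial]
  rw [Finset.sum_comm]
  refine Finset.sum_congr rfl fun i _ => ?_
  rw [Finset.sum_ite_eq]
  simp

theorem sum_coeff_X_sub_one_mul (s : ℝ[X]) (T : ℕ) :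
    ∑ j ∈ Finset.range (T + 1), ((X - C 1) * s).coeff j = -s.coeff T := by
  induction T with
  | zero => simp [sub_mul]
  | succ T ih =>
    rw [Finset.sum_range_succ, ih, sub_mul, coeff_sub, coeff_X_mul, coeff_C_mul]
    ring

/-- Symmetric binomial weights. -/
def binWeight (N : ℕ) (k : Fin (N + 1)) : ℝ := N.choose k / 2 ^ N

theorem ratWeights_binWeight (N : ℕ) : RatWeights (binWeight N) where
  pos k := div_pos (by exact_mod_cast Nat.choose_pos (Nat.lt_succ_iff.1 k.2)) (by positivity)
  sum_eq_one := by
    simp only [binWeight]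
    rw [← Finset.sum_div, Fin.sum_univ_eq_sum_range (fun k => (N.choose k : ℝ)),
      ← Nat.cast_sum, Nat.sum_range_choose]
    simp
  rat k := ⟨N.choose k / 2 ^ N, by simp [binWeight]⟩

theorem genPoly_binWeight (N : ℕ) :
    genPoly (binWeight N) (fun k => (k : ℕ)) = C (2 ^ N)⁻¹ * (1 + X) ^ N := by
  ext j
  rw [coeff_C_mul, coeff_one_add_X_pow]
  simp only [genPoly, finsetSum_coeff, coeff_monomial, binWeight]
  rw [Fin.sum_univ_eq_sum_range (fun k => if k = j then (N.choose k : ℝ) / 2 ^ N else 0),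
    Finset.sum_ite_eq']
  split_ifs with h
  · ring
  · rw [Nat.choose_eq_zero_of_lt (by simpa using h)]
    simp

/-- If the generating functions of two families are strictly ordered on `(0, ∞)` in the way
prescribed by the statistics `K_a`, then the families are ordered by stochastic dominance after
adding an independent binomial variable. -/
theorem exists_binomial_dominance {w : ι → ℝ} {v : κ → ℝ} (hw : ∑ i, w i = 1)
    (hv : ∑ j, v j = 1) (m : ι → ℕ) (n : κ → ℕ)
    (hgt : ∀ t, 1 < t → (genPoly v n).eval t < (genPoly w m).eval t)
    (hlt : ∀ t, 0 < t → t < 1 → (genPoly w m).eval t < (genPoly v n).eval t)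
    (hmean : ∑ j, n j * v j < ∑ i, m i * w i) :
    ∃ N : ℕ, ∀ T : ℕ,
      (∑ p : ι × Fin (N + 1), if m p.1 + p.2 ≤ T then w p.1 * binWeight N p.2 else 0) ≤
        ∑ p : κ × Fin (N + 1), if n p.1 + p.2 ≤ T then v p.1 * binWeight N p.2 else 0 := by
  have hroot : (genPoly w m - genPoly v n).IsRoot 1 := by
    simp [eval_genPoly, hw, hv]
  obtain ⟨r, hr⟩ := dvd_iff_isRoot.2 hroot
  have heval : ∀ t, (genPoly w m).eval t - (genPoly v n).eval t = (t - 1) * r.eval t := by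
    intro t
    simpa using congrArg (eval t) hr
  have hrpos : ∀ t, 0 < t → 0 < r.eval t := by
    intro t ht
    rcases lt_trichotomy t 1 with h | rfl | h
    · have h1 := hlt t ht h
      have h2 := heval t
      nlinarith
    · have h1 := congrArg (fun P => (derivative P).eval 1) hr
      simp [eval_one_derivative_genPoly] at h1
      linarith
    · have h1 := hgt t h
      have h2 := heval t
      nlinarith
  obtain ⟨N, hN⟩ := exists_pow_mul_coeff_nonneg hrpos
  refine ⟨N, fun T => ?_⟩
  rw [← sum_coeff_genPoly, ← sum_coeff_genPoly, ← sub_nonpos, ← Finset.sum_sub_distrib]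
  rw [← genPoly_mul w m (binWeight N) (fun k => (k : ℕ)),
    ← genPoly_mul v n (binWeight N) (fun k => (k : ℕ)), genPoly_binWeight]
  simp only [← coeff_sub]
  rw [← sub_mul, hr, mul_assoc, sum_coeff_X_sub_one_mul, mul_left_comm, coeff_C_mul, mul_comm r]
  simpa using mul_nonneg (by positivity : (0 : ℝ) ≤ (2 ^ N)⁻¹) (hN T)

theorem MASQ.le_of_apply_le {Φ : (ℝ → ℝ) → ℝ} (hΦ : MASQ Φ) {w : ι → ℝ} (hw : RatWeights w)
    {x y : ι → ℝ} (hxy : ∀ i, x i ≤ y i) : Φ (law w x) ≤ Φ (law w y) := by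
  refine hΦ.2.2 _ _ (hw.isDeltaQ y) (hw.isDeltaQ x) fun t => ?_
  rw [cdfOf_law, cdfOf_law]
  refine Finset.sum_le_sum fun i _ => ?_
  by_cases h : y i ≤ t
  · rw [if_pos h, if_pos ((hxy i).trans h)]
  · rw [if_neg h]
    split_ifs
    exacts [(hw.pos i).le, le_rfl]

theorem MASQ.map_law_add {Φ : (ℝ → ℝ) → ℝ} (hΦ : MASQ Φ) {w : ι → ℝ} {v : κ → ℝ}
    (hw : RatWeights w) (hv : RatWeights v) (x : ι → ℝ) (y : κ → ℝ) :
    Φ (law (fun p : ι × κ => w p.1 * v p.2) (fun p => x p.1 + y p.2)) =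
      Φ (law w x) + Φ (law v y) := by
  rw [← conv_law]
  exact hΦ.2.1 _ _ (hw.isDeltaQ x) (hv.isDeltaQ y)

theorem MASQ.map_law_add_const {Φ : (ℝ → ℝ) → ℝ} (hΦ : MASQ Φ) {w : ι → ℝ} (hw : RatWeights w)
    (x : ι → ℝ) (c : ℝ) : Φ (law w (fun i => x i + c)) = Φ (law w x) + c := by
  have h := hΦ.map_law_add hw ratWeights_one x (fun _ => c)
  rw [law_const ratWeights_one.sum_eq_one, hΦ.1] at h
  rw [← h]
  congr 1
  funext t
  simp [law, Fintype.sum_prod_type]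

theorem mgfOf_lattice (w : ι → ℝ) (m : ι → ℕ) (B δ a : ℝ) :
    mgfOf w (fun i => B + δ * m i) a =
      Real.exp (a * B) * (genPoly w m).eval (Real.exp (a * δ)) := by
  rw [eval_genPoly, mgfOf, Finset.mul_sum]
  refine Finset.sum_congr rfl fun i _ => ?_
  rw [← Real.exp_nat_mul, mul_add, Real.exp_add]
  ring_nf

/-- Strict version of the comparison theorem for lotteries on a common lattice. -/
theorem MASQ.lattice_le {Φ : (ℝ → ℝ) → ℝ} (hΦ : MASQ Φ) {w : ι → ℝ} {v : κ → ℝ}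
    (hw : RatWeights w) (hv : RatWeights v) {m : ι → ℕ} {n : κ → ℕ} {B δ : ℝ} (hδ : 0 < δ)
    (hgt : ∀ a, 0 < a →
      mgfOf v (fun j => B + δ * n j) a < mgfOf w (fun i => B + δ * m i) a)
    (hlt : ∀ a, a < 0 →
      mgfOf w (fun i => B + δ * m i) a < mgfOf v (fun j => B + δ * n j) a)
    (hmean : ∑ j, (B + δ * n j) * v j < ∑ i, (B + δ * m i) * w i) :
    Φ (law v fun j => B + δ * n j) ≤ Φ (law w fun i => B + δ * m i) := by
  have hexp : ∀ t, 0 < t → Real.exp (Real.log t / δ * δ) = t := fun t ht => by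
    rw [div_mul_cancel₀ _ hδ.ne', Real.exp_log ht]
  have hmean' : ∑ j, n j * v j < ∑ i, m i * w i := by
    simp only [add_mul, Finset.sum_add_distrib, ← Finset.mul_sum, hw.sum_eq_one, hv.sum_eq_one,
      mul_assoc] at hmean
    exact lt_of_mul_lt_mul_left (lt_of_add_lt_add_left hmean) hδ.le
  obtain ⟨N, hN⟩ := exists_binomial_dominance hw.sum_eq_one hv.sum_eq_one m n
    (fun t ht => by
      have h := hgt (Real.log t / δ) (div_pos (Real.log_pos ht) hδ)
      rw [mgfOf_lattice, mgfOf_lattice, hexp t (one_pos.trans ht)] at h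
      exact lt_of_mul_lt_mul_left h (Real.exp_pos _).le)
    (fun t ht ht1 => by
      have h := hlt (Real.log t / δ) (div_neg_of_neg_of_pos (Real.log_neg ht ht1) hδ)
      rw [mgfOf_lattice, mgfOf_lattice, hexp t ht] at h
      exact lt_of_mul_lt_mul_left h (Real.exp_pos _).le) hmean'
  have hb := ratWeights_binWeight N
  have hcdf : ∀ t (k l : ℕ), B + δ * k + δ * l ≤ t ↔
      B ≤ t ∧ k + l ≤ ⌊(t - B) / δ⌋₊ := by
    intro t k l
    constructor
    · intro h
      have hk : 0 ≤ δ * (k : ℝ) := by positivity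
      have hl : 0 ≤ δ * (l : ℝ) := by positivity
      have hBt : B ≤ t := by linarith
      refine ⟨hBt, Nat.le_floor ?_⟩
      rw [le_div_iff₀ hδ]
      push_cast
      linarith
    · rintro ⟨hBt, h⟩
      rw [Nat.le_floor_iff (div_nonneg (sub_nonneg.2 hBt) hδ.le), le_div_iff₀ hδ] at h
      push_cast at h
      linarith
  have hdom := hΦ.2.2 _ _
    ((hw.mul hb).isDeltaQ (fun p : ι × Fin (N + 1) => B + δ * m p.1 + δ * (p.2 : ℕ)))
    ((hv.mul hb).isDeltaQ (fun p : κ × Fin (N + 1) => B + δ * n p.1 + δ * (p.2 : ℕ)))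
    (fun t => by
      rw [cdfOf_law, cdfOf_law]
      simp only [hcdf]
      by_cases hBt : B ≤ t
      · simpa only [hBt, true_and] using hN ⌊(t - B) / δ⌋₊
      · simp [hBt])
  have e1 := hΦ.map_law_add hw hb (fun i => B + δ * m i) (fun k => δ * (k : ℕ))
  have e2 := hΦ.map_law_add hv hb (fun j => B + δ * n j) (fun k => δ * (k : ℕ))
  linarith

theorem mgfOf_add_const (w x : ι → ℝ) (c a : ℝ) :
    mgfOf w (fun i => x i + c) a = Real.exp (a * c) * mgfOf w x a := by
  simp only [mgfOf, Finset.mul_sum]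
  refine Finset.sum_congr rfl fun i _ => ?_
  rw [mul_add, Real.exp_add]
  ring

theorem mgfOf_mono {w x y : ι → ℝ} (hw : ∀ i, 0 < w i) {a : ℝ} (h : ∀ i, a * x i ≤ a * y i) :
    mgfOf w x a ≤ mgfOf w y a :=
  Finset.sum_le_sum fun i _ => mul_le_mul_of_nonneg_right (Real.exp_le_exp.2 (h i)) (hw i).le

theorem MASQ.le_add_of_mgfOf {Φ : (ℝ → ℝ) → ℝ} (hΦ : MASQ Φ) {w : ι → ℝ} {v : κ → ℝ}
    (hw : RatWeights w) (hv : RatWeights v) {x : ι → ℝ} {y : κ → ℝ}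
    (hgt : ∀ a, 0 < a → mgfOf v y a ≤ mgfOf w x a)
    (hlt : ∀ a, a < 0 → mgfOf w x a ≤ mgfOf v y a)
    (hmean : ∑ j, y j * v j ≤ ∑ i, x i * w i) {δ : ℝ} (hδ : 0 < δ) :
    Φ (law v y) ≤ Φ (law w x) + 3 * δ := by
  have := hw.nonempty
  obtain ⟨B₁, hB₁⟩ := (Set.finite_range x).bddBelow
  obtain ⟨B₂, hB₂⟩ := (Set.finite_range y).bddBelow
  obtain ⟨B, hBx, hBy⟩ : ∃ B, (∀ i, B ≤ x i) ∧ ∀ j, B ≤ y j :=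
    ⟨min B₁ B₂, fun i => (min_le_left _ _).trans (hB₁ ⟨i, rfl⟩),
      fun j => (min_le_right _ _).trans (hB₂ ⟨j, rfl⟩)⟩
  have hfloor : ∀ s, B ≤ s → δ * ⌊(s - B) / δ⌋₊ ≤ s - B ∧ s - B ≤ δ * (⌊(s - B) / δ⌋₊ + 1) := by
    intro s hs
    have h0 : 0 ≤ (s - B) / δ := div_nonneg (sub_nonneg.2 hs) hδ.le
    have h1 := Nat.floor_le h0
    have h2 := (Nat.lt_floor_add_one ((s - B) / δ)).le
    rw [le_div_iff₀ hδ] at h1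
    rw [div_le_iff₀ hδ] at h2
    constructor <;> linarith
  set m : ι → ℕ := fun i => ⌊(x i - B) / δ⌋₊ + 3 with hm
  set n : κ → ℕ := fun j => ⌊(y j - B) / δ⌋₊ + 1 with hn
  have hx1 : ∀ i, x i + 2 * δ ≤ B + δ * m i := fun i => by
    have := (hfloor _ (hBx i)).2
    simp only [hm]; push_cast; linarith
  have hx2 : ∀ i, B + δ * m i ≤ x i + 3 * δ := fun i => by
    have := (hfloor _ (hBx i)).1
    simp only [hm]; push_cast; linarith
  have hy1 : ∀ j, y j ≤ B + δ * n j := fun j => by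
    have := (hfloor _ (hBy j)).2
    simp only [hn]; push_cast; linarith
  have hy2 : ∀ j, B + δ * n j ≤ y j + δ := fun j => by
    have := (hfloor _ (hBy j)).1
    simp only [hn]; push_cast; linarith
  have hlat : Φ (law v fun j => B + δ * n j) ≤ Φ (law w fun i => B + δ * m i) := by
    refine hΦ.lattice_le hw hv hδ (fun a ha => ?_) (fun a ha => ?_) ?_
    · calc mgfOf v (fun j => B + δ * n j) a ≤ mgfOf v (fun j => y j + δ) a :=
            mgfOf_mono hv.pos fun j => mul_le_mul_of_nonneg_left (hy2 j) ha.le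
        _ = Real.exp (a * δ) * mgfOf v y a := mgfOf_add_const ..
        _ ≤ Real.exp (a * δ) * mgfOf w x a :=
            mul_le_mul_of_nonneg_left (hgt a ha) (Real.exp_pos _).le
        _ < Real.exp (a * (2 * δ)) * mgfOf w x a :=
            mul_lt_mul_of_pos_right (Real.exp_lt_exp.2 (by nlinarith)) (mgfOf_pos hw.pos x a)
        _ = mgfOf w (fun i => x i + 2 * δ) a := (mgfOf_add_const ..).symm
        _ ≤ _ := mgfOf_mono hw.pos fun i => mul_le_mul_of_nonneg_left (hx1 i) ha.le
    · calc mgfOf w (fun i => B + δ * m i) a ≤ mgfOf w (fun i => x i + 2 * δ) a :=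
            mgfOf_mono hw.pos fun i => mul_le_mul_of_nonpos_left (hx1 i) ha.le
        _ = Real.exp (a * (2 * δ)) * mgfOf w x a := mgfOf_add_const ..
        _ < Real.exp (a * δ) * mgfOf w x a :=
            mul_lt_mul_of_pos_right (Real.exp_lt_exp.2 (by nlinarith)) (mgfOf_pos hw.pos x a)
        _ ≤ Real.exp (a * δ) * mgfOf v y a :=
            mul_le_mul_of_nonneg_left (hlt a ha) (Real.exp_pos _).le
        _ = mgfOf v (fun j => y j + δ) a := (mgfOf_add_const ..).symm
        _ ≤ _ := mgfOf_mono hv.pos fun j => mul_le_mul_of_nonpos_left (hy2 j) ha.le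
    · calc ∑ j, (B + δ * n j) * v j ≤ ∑ j, (y j + δ) * v j :=
            Finset.sum_le_sum fun j _ => mul_le_mul_of_nonneg_right (hy2 j) (hv.pos j).le
        _ = ∑ j, y j * v j + δ := by
            simp only [add_mul, Finset.sum_add_distrib, ← Finset.mul_sum, hv.sum_eq_one, mul_one]
        _ < ∑ i, x i * w i + 2 * δ := by linarith
        _ = ∑ i, (x i + 2 * δ) * w i := by
            simp only [add_mul, Finset.sum_add_distrib, ← Finset.mul_sum, hw.sum_eq_one, mul_one]
        _ ≤ _ := Finset.sum_le_sum fun i _ => mul_le_mul_of_nonneg_right (hx1 i) (hw.pos i).le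
  calc Φ (law v y) ≤ Φ (law v fun j => B + δ * n j) := hΦ.le_of_apply_le hv hy1
    _ ≤ Φ (law w fun i => B + δ * m i) := hlat
    _ ≤ Φ (law w fun i => x i + 3 * δ) := hΦ.le_of_apply_le hw hx2
    _ = _ := hΦ.map_law_add_const hw x _

/-- A monotone additive statistic is monotone with respect to the family `K_a`. -/
theorem MASQ.le_of_Kstat_le {Φ : (ℝ → ℝ) → ℝ} (hΦ : MASQ Φ) {w : ι → ℝ} {v : κ → ℝ}
    (hw : RatWeights w) (hv : RatWeights v) {x : ι → ℝ} {y : κ → ℝ}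
    (hK : ∀ a, Kstat a (law v y) ≤ Kstat a (law w x)) : Φ (law v y) ≤ Φ (law w x) := by
  have := hw.nonempty
  have := hv.nonempty
  refine le_of_forall_pos_le_add fun ε hε => ?_
  have h := hΦ.le_add_of_mgfOf (δ := ε / 3) hw hv (x := x) (y := y) (fun a ha => ?_)
    (fun a ha => ?_) ?_ (by positivity)
  · linarith
  · have h := hK a
    rw [Kstat_coe_law ha.ne', Kstat_coe_law ha.ne'] at h
    exact (Real.log_le_log_iff (mgfOf_pos hv.pos y a) (mgfOf_pos hw.pos x a)).1
      (le_of_mul_le_mul_left h (inv_pos.2 ha))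
  · have h := hK a
    rw [Kstat_coe_law ha.ne, Kstat_coe_law ha.ne] at h
    exact (Real.log_le_log_iff (mgfOf_pos hw.pos x a) (mgfOf_pos hv.pos y a)).1
      ((mul_le_mul_left_of_neg (inv_lt_zero.2 ha)).1 h)
  · simpa [Kstat_zero, expOf_law] using hK 0

end Lattice

/-! ## The integral representation -/

section Representation

theorem IsDeltaQ.conv {f g : ℝ → ℝ} (hf : IsDeltaQ f) (hg : IsDeltaQ g) :
    IsDeltaQ (conv f g) := by
  obtain ⟨ι, _, w, x, hw, rfl⟩ := hf.exists_law
  obtain ⟨κ, _, v, y, hv, rfl⟩ := hg.exists_law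
  rw [conv_law]
  exact (hw.mul hv).isDeltaQ _

theorem isDeltaQ_delta (c : ℝ) : IsDeltaQ (delta c) := by
  rw [← law_const ratWeights_one.sum_eq_one c]
  exact ratWeights_one.isDeltaQ _

theorem Kstat_conv {f g : ℝ → ℝ} (hf : IsDeltaQ f) (hg : IsDeltaQ g) (a : EReal) :
    Kstat a (Paper.conv f g) = Kstat a f + Kstat a g := by
  obtain ⟨ι, _, w, x, hw, rfl⟩ := hf.exists_law
  obtain ⟨κ, _, v, y, hv, rfl⟩ := hg.exists_law
  rw [conv_law]
  exact Kstat_law_add hw hv x y a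

theorem IsDeltaQ.continuous_Kstat {f : ℝ → ℝ} (hf : IsDeltaQ f) :
    Continuous fun a => Kstat a f := by
  obtain ⟨ι, _, w, x, hw, rfl⟩ := hf.exists_law
  exact Paper.continuous_Kstat hw x

theorem MASQ.mono_Kstat {Φ : (ℝ → ℝ) → ℝ} (hΦ : MASQ Φ) {f g : ℝ → ℝ} (hf : IsDeltaQ f)
    (hg : IsDeltaQ g) (h : ∀ a, Kstat a g ≤ Kstat a f) : Φ g ≤ Φ f := by
  obtain ⟨ι, _, w, x, hw, rfl⟩ := hf.exists_law
  obtain ⟨κ, _, v, y, hv, rfl⟩ := hg.exists_law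
  exact hΦ.le_of_Kstat_le hw hv h

/-- The function `a ↦ K_a[X]` as a continuous function on the extended real line. -/
def Kmap (f : {f // IsDeltaQ f}) : C(EReal, ℝ) := ⟨fun a => Kstat a f, f.2.continuous_Kstat⟩

/-- The pairs `(K[X] - K[Y], Φ[X] - Φ[Y])`. -/
def diffGroup (Φ : (ℝ → ℝ) → ℝ) (hΦ : MASQ Φ) : AddSubgroup (C(EReal, ℝ) × ℝ) where
  carrier := {p | ∃ f g : {f // IsDeltaQ f}, p = (Kmap f - Kmap g, Φ f - Φ g)}
  zero_mem' := ⟨⟨_, isDeltaQ_delta 0⟩, ⟨_, isDeltaQ_delta 0⟩, by simp; rfl⟩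
  add_mem' := by
    rintro _ _ ⟨f, g, rfl⟩ ⟨f', g', rfl⟩
    refine ⟨⟨_, f.2.conv f'.2⟩, ⟨_, g.2.conv g'.2⟩, Prod.ext ?_ ?_⟩
    · ext a
      simp only [Kmap, Prod.mk_add_mk, ContinuousMap.add_apply, ContinuousMap.sub_apply,
        ContinuousMap.coe_mk, Kstat_conv f.2 f'.2, Kstat_conv g.2 g'.2]
      ring
    · simp only [Prod.mk_add_mk, hΦ.2.1 _ _ f.2 f'.2, hΦ.2.1 _ _ g.2 g'.2]
      ring
  neg_mem' := by
    rintro _ ⟨f, g, rfl⟩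
    exact ⟨g, f, by simp⟩

theorem MASQ.nonneg_of_mem_diffGroup {Φ : (ℝ → ℝ) → ℝ} (hΦ : MASQ Φ) {p : C(EReal, ℝ) × ℝ}
    (hp : p ∈ diffGroup Φ hΦ) (h : ∀ a, 0 ≤ p.1 a) : 0 ≤ p.2 := by
  obtain ⟨f, g, rfl⟩ := hp
  exact sub_nonneg.2 (hΦ.mono_Kstat f.2 g.2 fun a => sub_nonneg.1 (h a))

theorem MASQ.apply_mem_diffGroup {Φ : (ℝ → ℝ) → ℝ} (hΦ : MASQ Φ) (f : {f // IsDeltaQ f}) :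
    (Kmap f, Φ f) ∈ diffGroup Φ hΦ := by
  refine ⟨f, ⟨_, isDeltaQ_delta 0⟩, Prod.ext ?_ ?_⟩
  · ext a
    simp [Kmap, Kstat_delta]
  · simp [hΦ.1]

theorem Kmap_delta (c : ℝ) : Kmap ⟨delta c, isDeltaQ_delta c⟩ = ContinuousMap.const _ c := by
  ext a
  simp [Kmap, Kstat_delta]

/-- Positivity of `Φ` on real linear combinations of the functions `a ↦ K_a[X]`. -/
theorem MASQ.linearCombination_nonneg {Φ : (ℝ → ℝ) → ℝ} (hΦ : MASQ Φ)
    (c : {f // IsDeltaQ f} →₀ ℝ)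
    (hc : ∀ a, 0 ≤ Finsupp.linearCombination ℝ Kmap c a) :
    0 ≤ Finsupp.linearCombination ℝ (fun f : {f // IsDeltaQ f} => Φ f) c := by
  set S := ∑ f ∈ c.support, c f * Φ f with hS
  have hS' : Finsupp.linearCombination ℝ (fun f : {f // IsDeltaQ f} => Φ f) c = S := by
    simp [Finsupp.linearCombination_apply, Finsupp.sum, hS]
  have hc' : ∀ a, 0 ≤ ∑ f ∈ c.support, c f * Kmap f a := by
    intro a
    simpa [Finsupp.linearCombination_apply, Finsupp.sum, ContinuousMap.sum_apply] using hc a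
  rw [hS']
  set B := ∑ f ∈ c.support, ‖Kmap f‖ with hB
  set B' := ∑ f ∈ c.support, |Φ f| with hB'
  have key : ∀ n : ℕ, 0 ≤ n * S + (B + B') := by
    intro n
    set z : {f // IsDeltaQ f} → ℤ := fun f => ⌈n * c f⌉ with hz
    have hzc : ∀ f, |z f - n * c f| ≤ 1 := fun f => by
      have h1 := Int.le_ceil (n * c f)
      have h2 := (Int.ceil_lt_add_one (n * c f)).le
      rw [abs_le]
      constructor <;> simp only [hz] <;> linarith
    have hmem : ∑ f ∈ c.support, z f • (Kmap f, Φ f) + (ContinuousMap.const _ B, B) ∈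
        diffGroup Φ hΦ := by
      refine add_mem (sum_mem fun f _ => zsmul_mem (hΦ.apply_mem_diffGroup f) _) ?_
      have h := hΦ.apply_mem_diffGroup ⟨delta B, isDeltaQ_delta B⟩
      rwa [Kmap_delta, hΦ.1] at h
    have hpos := hΦ.nonneg_of_mem_diffGroup hmem fun a => by
      have h1 : ∑ f ∈ c.support, (n * c f - z f) * Kmap f a ≤ B :=
        Finset.sum_le_sum fun f _ => by
          refine (le_abs_self _).trans ?_
          rw [abs_mul, abs_sub_comm]
          calc _ ≤ 1 * ‖Kmap f‖ := mul_le_mul (hzc f) ((Kmap f).norm_coe_le_norm a)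
                (abs_nonneg _) zero_le_one
            _ = _ := one_mul _
      have h2 := mul_nonneg (Nat.cast_nonneg (α := ℝ) n) (hc' a)
      rw [Finset.mul_sum] at h2
      simp only [sub_mul, Finset.sum_sub_distrib, mul_assoc] at h1
      simp [Prod.fst_sum, ContinuousMap.sum_apply]
      linarith
    have h1 : ∑ f ∈ c.support, (z f - n * c f) * Φ f ≤ B' :=
      Finset.sum_le_sum fun f _ => by
        refine (le_abs_self _).trans ?_
        rw [abs_mul]
        exact mul_le_of_le_one_left (abs_nonneg _) (hzc f)
    simp only [sub_mul, Finset.sum_sub_distrib, mul_assoc] at h1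
    rw [← Finset.mul_sum] at h1
    simp [Prod.snd_sum] at hpos
    linarith
  by_contra hneg
  rw [not_le] at hneg
  obtain ⟨n, hn⟩ := exists_nat_gt ((B + B') / -S)
  rw [div_lt_iff₀ (by linarith)] at hn
  linarith [key n]

theorem MASQ.exists_positive_extension {Φ : (ℝ → ℝ) → ℝ} (hΦ : MASQ Φ) :
    ∃ Λ : C(EReal, ℝ) →ₗ[ℝ] ℝ, (∀ f : {f // IsDeltaQ f}, Λ (Kmap f) = Φ f) ∧
      ∀ k : C(EReal, ℝ), 0 ≤ k → 0 ≤ Λ k := by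
  set T := Finsupp.linearCombination ℝ Kmap with hT
  set φ := Finsupp.linearCombination ℝ (fun f : {f // IsDeltaQ f} => Φ f) with hφ
  have hpos : ∀ c, (∀ a, 0 ≤ T c a) → 0 ≤ φ c := hΦ.linearCombination_nonneg
  have hker : ∀ c, T c = 0 → φ c = 0 := by
    intro c hc
    have h1 := hpos c fun a => by simp [hc]
    have h2 := hpos (-c) fun a => by simp [hc]
    rw [map_neg] at h2
    linarith
  obtain ⟨g, hg⟩ := T.rangeRestrict.exists_rightInverse_of_surjective T.range_rangeRestrict
  have hTg : ∀ k : LinearMap.range T, T (g k) = k := fun k =>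
    congrArg Subtype.val (LinearMap.congr_fun hg k)
  obtain ⟨Λ, hΛ, hΛpos⟩ := riesz_extension (PointedCone.positive ℝ C(EReal, ℝ))
    ⟨LinearMap.range T, φ ∘ₗ g⟩
    (fun k hk => hpos _ fun a => by rw [hTg k]; exact hk a)
    (fun k => by
      refine ⟨⟨Kmap ⟨delta ‖k‖, isDeltaQ_delta _⟩, ?_⟩, fun a => ?_⟩
      · exact ⟨Finsupp.single ⟨delta ‖k‖, isDeltaQ_delta _⟩ 1, by simp [hT]⟩
      · have := neg_le_of_abs_le (k.norm_coe_le_norm a)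
        simp only [Kmap_delta]
        simp
        linarith)
  refine ⟨Λ, fun f => ?_, fun k hk => hΛpos k hk⟩
  have hf : Kmap f ∈ LinearMap.range T := ⟨Finsupp.single f 1, by simp [hT]⟩
  have h := hΛ ⟨Kmap f, hf⟩
  have h0 := hker (g ⟨Kmap f, hf⟩ - Finsupp.single f 1) (by
    rw [map_sub, hTg]; simp [hT])
  rw [map_sub, sub_eq_zero] at h0
  rw [h]
  change φ (g _) = _
  rw [h0]
  simp [hφ]

/-- **Riesz–Markov–Kakutani** on a compact space, for functionals on `C(X, ℝ)`. -/
theorem exists_measure_of_positive {X : Type*} [TopologicalSpace X] [CompactSpace X] [T2Space X]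
    [MeasurableSpace X] [BorelSpace X] (Λ : C(X, ℝ) →ₗ[ℝ] ℝ)
    (hΛ : ∀ k : C(X, ℝ), 0 ≤ k → 0 ≤ Λ k) :
    ∃ μ : Measure X, ∀ k : C(X, ℝ), ∫ x, k x ∂μ = Λ k := by
  let L : CompactlySupportedContinuousMap X ℝ →ₗ[ℝ] C(X, ℝ) :=
    { toFun := fun k => k.toContinuousMap
      map_add' := fun _ _ => rfl
      map_smul' := fun _ _ => rfl }
  refine ⟨RealRMK.rieszMeasure (PositiveLinearMap.mk₀ (Λ ∘ₗ L) fun k hk => hΛ _ hk), fun k => ?_⟩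
  exact RealRMK.integral_rieszMeasure _
    (CompactlySupportedContinuousMap.continuousMapEquiv k)

end Representation

/-- every monotone additive statistic on `Δ_ℚ` is of the form
`Φ[X] = ∫_{ℝ̄} K_a[X] dμ(a)` for a Borel probability measure `μ` on `ℝ̄`. -/
theorem stmt18 (Φ : (ℝ → ℝ) → ℝ) (hΦ : MASQ Φ) :
    ∃ μ : Measure EReal, IsProbabilityMeasure μ ∧
      ∀ f, IsDeltaQ f → Φ f = PhiInt μ f := by
  obtain ⟨Λ, hΛ, hpos⟩ := hΦ.exists_positive_extension
  obtain ⟨μ, hμ⟩ := exists_measure_of_positive Λ hpos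
  have hK : ∀ f, IsDeltaQ f → Φ f = PhiInt μ f := fun f hf =>
    (hΛ ⟨f, hf⟩).symm.trans (hμ (Kmap ⟨f, hf⟩)).symm
  refine ⟨μ, isProbabilityMeasure_iff_real.2 ?_, hK⟩
  have h1 := hK _ (isDeltaQ_delta 1)
  simp only [PhiInt, Kstat_delta, hΦ.1, integral_const, smul_eq_mul, mul_one] at h1
  exact h1.symm

end Paper
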